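/- arXiv:1512.00083 — 2 statements merged into one kernel-verified Lean document; each statement's English description precedes it below -/
import Mathlib

section
/- Let a and n be positive integers, and let F be a union-closed family of subsets of [n] in which every element lies in at most a sets and with |F| = f(n,a) (an optimal family). Let t = min_{e∈[n]} |{S ∈ F : e ∉ S and S ∪ {e} ∈ F}| be the minimum number of twin pairs over all elements. If t ≥ 1, then (as integers) t ≤ 2(a - n + 1); in particular a ≥ n - 1 + t/2. -/
/-- A family of sets is union-closed if it contains the union of any two of its sets. -/
def UnionClosed (F : Finset (Finset ℕ)) : Prop :=
  ∀ S ∈ F, ∀ T ∈ F, S ∪ T ∈ F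

/-- `F` is a family of subsets of `[n] = {0, …, n-1}` (modeled as `Finset.range n`). -/
def FamilyOn (n : ℕ) (F : Finset (Finset ℕ)) : Prop :=
  ∀ S ∈ F, S ⊆ Finset.range n

/-- The degree of an element `e`: the number of sets of `F` containing `e`. -/
def degOf (F : Finset (Finset ℕ)) (e : ℕ) : ℕ :=
  (F.filter (fun S => e ∈ S)).card

/-- `franklF n a` is the maximum cardinality of a nonempty union-closed family of subsets
of `[n]` in which every element of `[n]` belongs to at most `a` sets. -/
noncomputable def franklF (n a : ℕ) : ℕ :=
  sSup {m | ∃ F : Finset (Finset ℕ), UnionClosed F ∧ FamilyOn n F ∧ F.Nonempty ∧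
    (∀ e ∈ Finset.range n, degOf F e ≤ a) ∧ F.card = m}

/-- `franklG n m` is the minimum, over union-closed families of subsets of `[n]` with
exactly `m` sets, of the maximum degree `max_{e ∈ [n]} |{S ∈ F : e ∈ S}|`. -/
noncomputable def franklG (n m : ℕ) : ℕ :=
  sInf {a | ∃ F : Finset (Finset ℕ), UnionClosed F ∧ FamilyOn n F ∧ F.card = m ∧
    (Finset.range n).sup (degOf F) = a}

/-- The number of twin pairs with twin difference `e`: sets `S ∈ F` with `e ∉ S`
and `S ∪ {e} ∈ F`. -/
def twinCount (F : Finset (Finset ℕ)) (e : ℕ) : ℕ :=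
  (F.filter (fun S => e ∉ S ∧ insert e S ∈ F)).card

/-- `e` is a non-trivial twin difference in `F` (as a family of subsets of `[n]`):
there is `S ∈ F` with `e ∉ S`, `S ∪ {e} ∈ F` and `S ∪ {e} ≠ [n]`. -/
def NonTrivialTwinDiff (n : ℕ) (F : Finset (Finset ℕ)) (e : ℕ) : Prop :=
  ∃ S ∈ F, e ∉ S ∧ insert e S ∈ F ∧ insert e S ≠ Finset.range n

/-- `franklFt n a`: maximum cardinality of a union-closed family of subsets of `[n]`
where every element of `[n]` lies in at most `a` sets and every element of `[n]` is a
non-trivial twin difference. -/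
noncomputable def franklFt (n a : ℕ) : ℕ :=
  sSup {m | ∃ F : Finset (Finset ℕ), UnionClosed F ∧ FamilyOn n F ∧
    (∀ e ∈ Finset.range n, degOf F e ≤ a) ∧
    (∀ e ∈ Finset.range n, NonTrivialTwinDiff n F e) ∧ F.card = m}

/-- `franklGt n m`: minimum of the maximum degree over union-closed families of subsets
of `[n]` with exactly `m` sets in which every element of `[n]` is a non-trivial twin
difference. -/
noncomputable def franklGt (n m : ℕ) : ℕ :=
  sInf {a | ∃ F : Finset (Finset ℕ), UnionClosed F ∧ FamilyOn n F ∧ F.card = m ∧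
    (∀ e ∈ Finset.range n, NonTrivialTwinDiff n F e) ∧
    (Finset.range n).sup (degOf F) = a}

/-- The union of all sets of `F` that avoid `e`. -/
def maxAvoiding (F : Finset (Finset ℕ)) (e : ℕ) : Finset ℕ :=
  (F.filter (fun S => e ∉ S)).sup id

theorem notMem_maxAvoiding (F : Finset (Finset ℕ)) (e : ℕ) : e ∉ maxAvoiding F e := by
  simp [maxAvoiding, Finset.mem_sup]

theorem subset_maxAvoiding {F : Finset (Finset ℕ)} {S : Finset ℕ} {e : ℕ}
    (hS : S ∈ F) (he : e ∉ S) : S ⊆ maxAvoiding F e :=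
  Finset.le_sup (f := id) (Finset.mem_filter.2 ⟨hS, he⟩)

theorem exists_twin {F : Finset (Finset ℕ)} {e : ℕ} (h : 0 < twinCount F e) :
    ∃ S ∈ F, e ∉ S ∧ insert e S ∈ F := by
  obtain ⟨S, hS⟩ := Finset.card_pos.1 h
  exact ⟨S, by simpa using hS⟩

theorem UnionClosed.sup_mem {F G : Finset (Finset ℕ)} (hF : UnionClosed F) (hGF : G ⊆ F)
    (hG : G.Nonempty) : G.sup id ∈ F := by
  rw [← Finset.sup'_eq_sup hG]
  exact Finset.sup'_mem (F : Set (Finset ℕ)) (fun S hS T hT => hF S hS T hT) _ hG id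
    fun S hS => hGF hS

theorem maxAvoiding_mem {F : Finset (Finset ℕ)} {e : ℕ} (hF : UnionClosed F)
    (h : 0 < twinCount F e) : maxAvoiding F e ∈ F := by
  obtain ⟨S, hS, heS, -⟩ := exists_twin h
  exact hF.sup_mem (Finset.filter_subset _ _) ⟨S, Finset.mem_filter.2 ⟨hS, heS⟩⟩

theorem mem_sup_of_twin {F : Finset (Finset ℕ)} {e : ℕ} (h : 0 < twinCount F e) :
    e ∈ F.sup id := by
  obtain ⟨S, -, -, hS⟩ := exists_twin h
  exact Finset.le_sup (f := id) hS (Finset.mem_insert_self e S)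

theorem maxAvoiding_ne_sup {F : Finset (Finset ℕ)} {e : ℕ} (h : 0 < twinCount F e) :
    maxAvoiding F e ≠ F.sup id := fun h' =>
  notMem_maxAvoiding F e (h' ▸ mem_sup_of_twin h)

theorem eq_of_maxAvoiding_eq {F : Finset (Finset ℕ)} {e x : ℕ} (h : 0 < twinCount F e)
    (hM : maxAvoiding F e = maxAvoiding F x) : e = x := by
  by_contra hne
  obtain ⟨S, hS, heS, hS'⟩ := exists_twin h
  have hx : x ∉ insert e S := by
    intro hx
    rcases Finset.mem_insert.1 hx with hx | hx
    · exact hne hx.symm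
    · exact notMem_maxAvoiding F x (hM ▸ subset_maxAvoiding hS heS hx)
  exact notMem_maxAvoiding F e
    (hM ▸ subset_maxAvoiding hS' hx (Finset.mem_insert_self e S))

/-- The elements `x ≠ e` of `R` such that deleting `e` from `maxAvoiding F x` gives a set of `F`
other than `maxAvoiding F e`. -/
def deletionNeighbors (R : Finset ℕ) (F : Finset (Finset ℕ)) (e : ℕ) : Finset ℕ :=
  (R.erase e).filter fun x =>
    (maxAvoiding F x).erase e ∈ F ∧ (maxAvoiding F x).erase e ≠ maxAvoiding F e

/-- Every `x` in a finite set `R` of twin differences lies below some `e ∈ R` that belongs to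
`maxAvoiding F y` for all other `y ∈ R`. -/
theorem exists_top_above {R : Finset ℕ} {F : Finset (Finset ℕ)} (hF : UnionClosed F)
    (hR : ∀ e ∈ R, 0 < twinCount F e) {x : ℕ} (hx : x ∈ R) :
    ∃ e ∈ R, x ∉ maxAvoiding F e ∧ ∀ y ∈ R, y ≠ e → e ∈ maxAvoiding F y := by
  obtain ⟨e, he, hmin⟩ := Finset.exists_min_image (R.filter fun y => x ∉ maxAvoiding F y)
    (fun y => (maxAvoiding F y).card) ⟨x, Finset.mem_filter.2 ⟨hx, notMem_maxAvoiding F x⟩⟩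
  rw [Finset.mem_filter] at he
  refine ⟨e, he.1, he.2, fun y hy hye => ?_⟩
  by_contra hey
  have hsub : maxAvoiding F y ⊆ maxAvoiding F e :=
    subset_maxAvoiding (maxAvoiding_mem hF (hR y hy)) hey
  have hle := hmin y (Finset.mem_filter.2 ⟨hy, fun h => he.2 (hsub h)⟩)
  exact hye (eq_of_maxAvoiding_eq (hR y hy) (Finset.eq_of_subset_of_card_le hsub hle))

/-- The sets `maxAvoiding F x` for `x ∈ R` other than `e`, together with the union of `F`. -/
def coreSets (R : Finset ℕ) (F : Finset (Finset ℕ)) (e : ℕ) : Finset (Finset ℕ) :=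
  insert (F.sup id) ((R.erase e).image (maxAvoiding F))

theorem card_coreSets {R : Finset ℕ} {F : Finset (Finset ℕ)} {e : ℕ}
    (hR : ∀ e ∈ R, 0 < twinCount F e) (he : e ∈ R) : (coreSets R F e).card = R.card := by
  rw [coreSets, Finset.card_insert_of_notMem, Finset.card_image_of_injOn,
    Finset.card_erase_add_one he]
  · intro x hx y _ hxy
    exact eq_of_maxAvoiding_eq (hR x (Finset.mem_of_mem_erase hx)) hxy
  · intro h
    obtain ⟨x, hx, hxU⟩ := Finset.mem_image.1 h
    exact maxAvoiding_ne_sup (hR x (Finset.mem_of_mem_erase hx)) hxU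

theorem coreSets_subset {R : Finset ℕ} {F : Finset (Finset ℕ)} {e : ℕ} (hF : UnionClosed F)
    (hR : ∀ e ∈ R, 0 < twinCount F e) (he : e ∈ R)
    (htop : ∀ y ∈ R, y ≠ e → e ∈ maxAvoiding F y) :
    coreSets R F e ⊆ F.filter (fun S => e ∈ S) := by
  intro S hS
  rw [Finset.mem_filter]
  rcases Finset.mem_insert.1 hS with rfl | hS
  · obtain ⟨T, hT, -⟩ := exists_twin (hR e he)
    exact ⟨hF.sup_mem subset_rfl ⟨T, hT⟩, mem_sup_of_twin (hR e he)⟩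
  · obtain ⟨x, hx, rfl⟩ := Finset.mem_image.1 hS
    rw [Finset.mem_erase] at hx
    exact ⟨maxAvoiding_mem hF (hR x hx.2), htop x hx.2 hx.1⟩

/-- The degree of `e` is at least `|coreSets|` plus the number of twin pairs at `e` that produce
neither `maxAvoiding F e` nor a core set. -/
theorem card_add_twinCount_le {R : Finset ℕ} {F : Finset (Finset ℕ)} {e : ℕ}
    (hF : UnionClosed F) (hR : ∀ e ∈ R, 0 < twinCount F e) (he : e ∈ R)
    (htop : ∀ y ∈ R, y ≠ e → e ∈ maxAvoiding F y) :
    R.card + twinCount F e ≤ degOf F e + (deletionNeighbors R F e).card + 1 := by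
  set T := (F.filter (fun S => e ∉ S ∧ insert e S ∈ F)).erase (maxAvoiding F e) with hT
  have hmem : ∀ S ∈ T, S ≠ maxAvoiding F e ∧ S ∈ F ∧ e ∉ S ∧ insert e S ∈ F := by
    intro S hS
    simpa [hT] using hS
  have hTcard : twinCount F e ≤ (T.image (insert e)).card + 1 := by
    rw [Finset.card_image_of_injOn]
    · have := Finset.pred_card_le_card_erase (a := maxAvoiding F e)
        (s := F.filter (fun S => e ∉ S ∧ insert e S ∈ F))
      rw [← hT] at this
      unfold twinCount
      omega
    · intro S hS S' hS' h
      rw [← Finset.erase_insert (hmem S hS).2.2.1, ← Finset.erase_insert (hmem S' hS').2.2.1]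
      exact congrArg (fun V => Finset.erase V e) h
  have hinter : coreSets R F e ∩ T.image (insert e) ⊆
      (deletionNeighbors R F e).image (maxAvoiding F) := by
    intro V hV
    obtain ⟨hV, hVT⟩ := Finset.mem_inter.1 hV
    obtain ⟨S, hS, rfl⟩ := Finset.mem_image.1 hVT
    obtain ⟨hSM, hSF, heS, -⟩ := hmem S hS
    rcases Finset.mem_insert.1 hV with hU | hV
    · refine absurd (Finset.Subset.antisymm (subset_maxAvoiding hSF heS) fun z hz => ?_) hSM
      have hsub : maxAvoiding F e ⊆ F.sup id := Finset.sup_mono (Finset.filter_subset _ _)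
      have hzU : z ∈ F.sup id := hsub hz
      rw [← hU] at hzU
      refine (Finset.mem_insert.1 hzU).resolve_left ?_
      rintro rfl
      exact notMem_maxAvoiding F z hz
    · obtain ⟨x, hx, hxS⟩ := Finset.mem_image.1 hV
      refine Finset.mem_image.2 ⟨x, Finset.mem_filter.2 ⟨hx, ?_⟩, hxS⟩
      rw [hxS, Finset.erase_insert heS]
      exact ⟨hSF, hSM⟩
  have hunion : coreSets R F e ∪ T.image (insert e) ⊆ F.filter (fun S => e ∈ S) := by
    refine Finset.union_subset (coreSets_subset hF hR he htop) fun V hV => ?_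
    obtain ⟨S, hS, rfl⟩ := Finset.mem_image.1 hV
    exact Finset.mem_filter.2 ⟨(hmem S hS).2.2.2, Finset.mem_insert_self e S⟩
  have h1 := Finset.card_union_add_card_inter (coreSets R F e) (T.image (insert e))
  have h2 := Finset.card_le_card hunion
  have h3 := (Finset.card_le_card hinter).trans Finset.card_image_le
  rw [card_coreSets hR he] at h1
  unfold degOf
  omega

/-- The deletions `maxAvoiding F x` without `e'` contribute to the degree of any other `e`
contained in all `maxAvoiding F y`, in addition to the core sets. -/
theorem card_add_deletionNeighbors_le {R : Finset ℕ} {F : Finset (Finset ℕ)} {e e' : ℕ}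
    (hF : UnionClosed F) (hR : ∀ e ∈ R, 0 < twinCount F e) (he : e ∈ R)
    (htop : ∀ y ∈ R, y ≠ e → e ∈ maxAvoiding F y)
    (htop' : ∀ y ∈ R, y ≠ e' → e' ∈ maxAvoiding F y) (hne : e ≠ e') :
    R.card + (deletionNeighbors R F e').card ≤ degOf F e + 1 := by
  set N := (deletionNeighbors R F e').erase e with hN
  have hmem : ∀ x ∈ N, x ≠ e ∧ x ≠ e' ∧ x ∈ R ∧ (maxAvoiding F x).erase e' ∈ F ∧
      (maxAvoiding F x).erase e' ≠ maxAvoiding F e' := by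
    intro x hx
    simpa [hN, deletionNeighbors, and_assoc] using hx
  have hcard : (N.image fun x => (maxAvoiding F x).erase e').card = N.card := by
    refine Finset.card_image_of_injOn fun x hx y hy hxy => ?_
    obtain ⟨-, hxe, hxR, -⟩ := hmem x hx
    obtain ⟨-, hye, hyR, -⟩ := hmem y hy
    refine eq_of_maxAvoiding_eq (hR x hxR) ?_
    rw [← Finset.insert_erase (htop' x hxR hxe), ← Finset.insert_erase (htop' y hyR hye)]
    exact congrArg (insert e') hxy
  have hdisj : Disjoint (coreSets R F e) (N.image fun x => (maxAvoiding F x).erase e') := by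
    rw [Finset.disjoint_right]
    intro V hV hcore
    obtain ⟨x, hx, rfl⟩ := Finset.mem_image.1 hV
    obtain ⟨-, hxe, hxR, -, hxM⟩ := hmem x hx
    rcases Finset.mem_insert.1 hcore with hU | hcore
    · have := mem_sup_of_twin (hR x hxR)
      rw [← hU] at this
      exact notMem_maxAvoiding F x (Finset.mem_of_mem_erase this)
    · obtain ⟨y, hy, hyx⟩ := Finset.mem_image.1 hcore
      by_cases hye : y = e'
      · exact hxM (hye ▸ hyx.symm)
      · have := htop' y (Finset.mem_of_mem_erase hy) hye
        rw [hyx] at this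
        exact Finset.notMem_erase e' _ this
  have hunion : coreSets R F e ∪ (N.image fun x => (maxAvoiding F x).erase e') ⊆
      F.filter (fun S => e ∈ S) := by
    refine Finset.union_subset (coreSets_subset hF hR he htop) fun V hV => ?_
    obtain ⟨x, hx, rfl⟩ := Finset.mem_image.1 hV
    obtain ⟨hxe, -, hxR, hxF, -⟩ := hmem x hx
    exact Finset.mem_filter.2 ⟨hxF, Finset.mem_erase.2 ⟨hne, htop x hxR hxe⟩⟩
  have h1 := Finset.card_le_card hunion
  rw [Finset.card_union_of_disjoint hdisj, card_coreSets hR he, hcard] at h1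
  have h2 := Finset.pred_card_le_card_erase (a := e) (s := deletionNeighbors R F e')
  rw [← hN] at h2
  unfold degOf
  omega

/-- For an optimal family `F` for `f(n,a)`, the minimum number `t` of twin pairs over
all elements of `[n]` satisfies `t ≤ 2(a - n + 1)` (as integers) whenever `t ≥ 1`. -/
theorem min_twinCount_bound (a n : ℕ) (ha : 0 < a) (hn : 0 < n)
    (F : Finset (Finset ℕ)) (hUC : UnionClosed F) (hFam : FamilyOn n F)
    (hne : F.Nonempty) (hdeg : ∀ e ∈ Finset.range n, degOf F e ≤ a)
    (hopt : F.card = franklF n a)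
    (t : ℕ) (ht_min : ∀ e ∈ Finset.range n, t ≤ twinCount F e)
    (ht_attained : ∃ e ∈ Finset.range n, twinCount F e = t)
    (ht : 1 ≤ t) :
    (t : ℤ) ≤ 2 * ((a : ℤ) - (n : ℤ) + 1) := by
  have hR : ∀ e ∈ Finset.range n, 0 < twinCount F e := fun e he => ht.trans (ht_min e he)
  obtain ⟨e, he, -, htop⟩ := exists_top_above hUC hR (Finset.mem_range.2 hn)
  have h1 := card_add_twinCount_le hUC hR he htop
  have h2 := ht_min e he
  have h3 := hdeg e he
  rw [Finset.card_range] at h1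
  rcases (deletionNeighbors (Finset.range n) F e).eq_empty_or_nonempty with hN | ⟨x, hx⟩
  · rw [hN, Finset.card_empty] at h1
    omega
  · obtain ⟨hx, hxF, hxM⟩ := Finset.mem_filter.1 hx
    obtain ⟨hxe, hxR⟩ := Finset.mem_erase.1 hx
    obtain ⟨e', he', hxe', htop'⟩ := exists_top_above hUC hR hxR
    have hne' : e' ≠ e := by
      rintro rfl
      refine hxM (Finset.Subset.antisymm
        (subset_maxAvoiding hxF (Finset.notMem_erase _ _)) ?_)
      rw [Finset.subset_erase]
      exact ⟨subset_maxAvoiding (maxAvoiding_mem hUC (hR e' he')) hxe',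
        notMem_maxAvoiding F e'⟩
    have h4 := card_add_deletionNeighbors_le hUC hR he' htop' htop hne'
    have h5 := hdeg e' he'
    rw [Finset.card_range] at h4
    omega
end

section
/- Let a and n be positive integers with n ≥ ⌈log₂ a⌉ + 1, and suppose f(n,a) < f(n+1,a). Let F be a union-closed family of subsets of [n+1] in which every element lies in at most a sets and with |F| = f(n+1,a). Then for every element e ∈ [n+1], the family F' = {S \ {e} : S ∈ F} obtained by deleting e from every set of F satisfies |F'| < f(n,a); in particular, F' is never an optimal family for f(n,a). -/
theorem UnionClosed.image_of_map_union {F : Finset (Finset ℕ)} (hF : UnionClosed F)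
    (φ : Finset ℕ → Finset ℕ) (hφ : ∀ S T, φ (S ∪ T) = φ S ∪ φ T) :
    UnionClosed (F.image φ) := by
  intro S hS T hT
  obtain ⟨A, hA, rfl⟩ := Finset.mem_image.1 hS
  obtain ⟨B, hB, rfl⟩ := Finset.mem_image.1 hT
  exact Finset.mem_image.2 ⟨A ∪ B, hF A hA B hB, hφ A B⟩

/-- The maximum defining `franklF` bounds every admissible family. -/
theorem card_le_franklF {n a : ℕ} {F : Finset (Finset ℕ)} (hUC : UnionClosed F)
    (hFam : FamilyOn n F) (hne : F.Nonempty) (hdeg : ∀ e ∈ Finset.range n, degOf F e ≤ a) :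
    F.card ≤ franklF n a := by
  refine le_csSup ⟨(Finset.range n).powerset.card, ?_⟩ ⟨F, hUC, hFam, hne, hdeg, rfl⟩
  rintro m ⟨G, -, hG, -, -, rfl⟩
  exact Finset.card_le_card fun S hS => Finset.mem_powerset.2 (hG S hS)

/-- The bound by `franklF n a` also holds for families on `[n+1] \ {e}`. -/
theorem card_le_franklF_of_subset_erase {n a e : ℕ} (he : e ∈ Finset.range (n + 1))
    {G : Finset (Finset ℕ)} (hUC : UnionClosed G)
    (hG : ∀ S ∈ G, S ⊆ (Finset.range (n + 1)).erase e) (hne : G.Nonempty)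
    (hdeg : ∀ x ∈ (Finset.range (n + 1)).erase e, degOf G x ≤ a) :
    G.card ≤ franklF n a := by
  have hinj : Function.Injective (Finset.image (Equiv.swap e n)) :=
    Finset.image_injective (Equiv.swap e n).injective
  have he' : e < n + 1 := Finset.mem_range.1 he
  rw [← Finset.card_image_of_injective G hinj]
  refine card_le_franklF
    (hUC.image_of_map_union _ fun S T => Finset.image_union S T) ?_ (hne.image _) ?_
  · intro S hS y hy
    obtain ⟨A, hA, rfl⟩ := Finset.mem_image.1 hS
    obtain ⟨x, hx, rfl⟩ := Finset.mem_image.1 hy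
    have hxX := hG A hA hx
    simp only [Finset.mem_erase, Finset.mem_range] at hxX ⊢
    rw [Equiv.swap_apply_def]
    split_ifs <;> omega
  · intro y hy
    have hy' : Equiv.swap e n y ∈ (Finset.range (n + 1)).erase e := by
      simp only [Finset.mem_erase, Finset.mem_range] at hy ⊢
      rw [Equiv.swap_apply_def]
      split_ifs <;> omega
    refine le_trans (le_of_eq ?_) (hdeg _ hy')
    unfold degOf
    rw [Finset.filter_image, Finset.card_image_of_injective _ hinj]
    congr 1
    refine Finset.filter_congr fun S _ => ?_
    rw [Finset.mem_image]
    constructor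
    · rintro ⟨x, hx, rfl⟩
      simpa using hx
    · exact fun h => ⟨_, h, by simp⟩

theorem degOf_insert_le (G : Finset (Finset ℕ)) (T : Finset ℕ) (x : ℕ) :
    degOf (insert T G) x ≤ degOf G x + 1 := by
  unfold degOf
  rw [Finset.filter_insert]
  split_ifs
  · exact Finset.card_insert_le _ _
  · exact Nat.le_succ _

theorem two_pow_le_degOf_powerset {X : Finset ℕ} {x : ℕ} (hx : x ∈ X) :
    2 ^ (X.card - 1) ≤ degOf X.powerset x := by
  rw [← Finset.card_erase_of_mem hx, ← Finset.card_powerset]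
  refine Finset.card_le_card_of_injOn (insert x) ?_ ?_
  · intro S hS
    have hS' : S ⊆ X.erase x := Finset.mem_powerset.1 hS
    exact Finset.mem_filter.2 ⟨Finset.mem_powerset.2 (Finset.insert_subset hx
      (hS'.trans (Finset.erase_subset _ _))), Finset.mem_insert_self _ _⟩
  · intro S hS T hT h
    have hxS : x ∉ S := fun h' => Finset.notMem_erase x X (Finset.mem_powerset.1 hS h')
    have hxT : x ∉ T := fun h' => Finset.notMem_erase x X (Finset.mem_powerset.1 hT h')
    rw [← Finset.erase_insert hxS, ← Finset.erase_insert hxT]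
    exact congrArg (Finset.erase · x) h

theorem UnionClosed.insert_of_maximal {X T : Finset ℕ} {G : Finset (Finset ℕ)}
    (hUC : UnionClosed G) (hG : ∀ S ∈ G, S ⊆ X)
    (hT : Maximal (· ∈ X.powerset \ G) T) : UnionClosed (insert T G) := by
  have hTX : T ⊆ X := Finset.mem_powerset.1 (Finset.mem_sdiff.1 hT.prop).1
  have key : ∀ S ∈ G, T ∪ S ∈ insert T G := by
    intro S hS
    by_cases h : T ∪ S ∈ G
    · exact Finset.mem_insert_of_mem h
    · have hmem : T ∪ S ∈ X.powerset \ G :=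
        Finset.mem_sdiff.2 ⟨Finset.mem_powerset.2 (Finset.union_subset hTX (hG S hS)), h⟩
      rw [← hT.eq_of_le hmem Finset.subset_union_left]
      exact Finset.mem_insert_self _ _
  intro A hA B hB
  rcases Finset.mem_insert.1 hA with rfl | hA' <;> rcases Finset.mem_insert.1 hB with rfl | hB'
  · simp
  · exact key B hB'
  · rw [Finset.union_comm]
    exact key A hA'
  · exact Finset.mem_insert_of_mem (hUC A hA' B hB')

theorem filter_image_erase {F : Finset (Finset ℕ)} {e x : ℕ} (hxe : x ≠ e) :
    (F.image (fun S => S.erase e)).filter (fun S => x ∈ S) =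
      (F.filter (fun S => x ∈ S)).image (fun S => S.erase e) := by
  rw [Finset.filter_image]
  simp [hxe]

/-- If `F` contains both `S` and `S ∪ {e}`, then deleting `e` makes every other degree
drop strictly below the maximum. -/
theorem degOf_image_erase_lt {F : Finset (Finset ℕ)} {a e x : ℕ} {S : Finset ℕ}
    (hUC : UnionClosed F) (hxe : x ≠ e) (hx : degOf F x ≤ a) (he : degOf F e ≤ a)
    (heS : e ∉ S) (hS : S ∈ F) (hSe : insert e S ∈ F) :
    degOf (F.image (fun S => S.erase e)) x < a := by
  have hle : degOf (F.image (fun S => S.erase e)) x ≤ degOf F x := by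
    unfold degOf
    rw [filter_image_erase hxe]
    exact Finset.card_image_le
  by_cases h : ∃ R ∈ F, e ∉ R ∧ x ∈ R
  · obtain ⟨R, hR, heR, hxR⟩ := h
    refine lt_of_lt_of_le (lt_of_le_of_ne hle fun heq => ?_) hx
    unfold degOf at heq
    rw [filter_image_erase hxe] at heq
    have hinj := Finset.card_image_iff.1 heq
    have hW : R ∪ S ∈ F := hUC R hR S hS
    have hWe : insert e (R ∪ S) ∈ F := by
      rw [← Finset.union_insert]
      exact hUC R hR _ hSe
    have heW : e ∉ R ∪ S := by simp [heR, heS]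
    have heq' : R ∪ S = insert e (R ∪ S) := by
      refine hinj (Finset.mem_coe.2 (Finset.mem_filter.2 ⟨hW, by simp [hxR]⟩))
        (Finset.mem_coe.2 (Finset.mem_filter.2 ⟨hWe, by simp [hxR]⟩)) ?_
      simp only [Finset.erase_insert heW, Finset.erase_eq_of_notMem heW]
    exact heW (heq' ▸ Finset.mem_insert_self e (R ∪ S))
  · push Not at h
    refine lt_of_le_of_lt hle (lt_of_lt_of_le (Finset.card_lt_card ?_) he)
    refine Finset.ssubset_iff_of_subset ?_ |>.2 ⟨insert e S, ?_, ?_⟩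
    · intro R hR
      obtain ⟨hRF, hxR⟩ := Finset.mem_filter.1 hR
      exact Finset.mem_filter.2 ⟨hRF, by_contra fun heR => h R hRF heR hxR⟩
    · exact Finset.mem_filter.2 ⟨hSe, Finset.mem_insert_self _ _⟩
    · intro hmem
      have hxS := (Finset.mem_filter.1 hmem).2
      exact h S hS heS (Finset.mem_of_mem_insert_of_ne hxS hxe)

theorem exists_insert_mem_of_card_image_erase_ne {F : Finset (Finset ℕ)} {e : ℕ}
    (h : (F.image (fun S => S.erase e)).card ≠ F.card) :
    ∃ S ∈ F, e ∉ S ∧ insert e S ∈ F := by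
  by_contra! hno
  refine h (Finset.card_image_of_injOn fun A hA B hB hAB => ?_)
  replace hAB : A.erase e = B.erase e := hAB
  by_cases hAe : e ∈ A <;> by_cases hBe : e ∈ B
  · rw [← Finset.insert_erase hAe, hAB, Finset.insert_erase hBe]
  · rw [Finset.erase_eq_of_notMem hBe] at hAB
    exact absurd (by rwa [← hAB, Finset.insert_erase hAe]) (hno B hB hBe)
  · rw [Finset.erase_eq_of_notMem hAe] at hAB
    exact absurd (by rwa [hAB, Finset.insert_erase hBe]) (hno A hA hAe)
  · rwa [Finset.erase_eq_of_notMem hAe, Finset.erase_eq_of_notMem hBe] at hAB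

/-- If `f(n,a) < f(n+1,a)` and `F` is an optimal family for `f(n+1,a)`, then for every
element `e ∈ [n+1]`, deleting `e` from every set of `F` yields a family with fewer than
`f(n,a)` sets; in particular it is never optimal for `f(n,a)`. -/
theorem delete_element_not_optimal (a n : ℕ) (ha : 0 < a) (hn : 0 < n)
    (hlog : Nat.clog 2 a + 1 ≤ n) (hlt : franklF n a < franklF (n + 1) a)
    (F : Finset (Finset ℕ)) (hUC : UnionClosed F) (hFam : FamilyOn (n + 1) F)
    (hdeg : ∀ e ∈ Finset.range (n + 1), degOf F e ≤ a)
    (hopt : F.card = franklF (n + 1) a) :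
    ∀ e ∈ Finset.range (n + 1), (F.image (fun S => S.erase e)).card < franklF n a := by
  intro e he
  set G := F.image (fun S => S.erase e) with hGdef
  set X := (Finset.range (n + 1)).erase e with hX
  have hXcard : X.card = n := by simp [hX, Finset.card_erase_of_mem he]
  have hFne : F.Nonempty := Finset.card_pos.1 (by omega)
  have hGX : ∀ S ∈ G, S ⊆ X := by
    intro S hS
    obtain ⟨A, hA, rfl⟩ := Finset.mem_image.1 hS
    exact Finset.erase_subset_erase e (hFam A hA)
  have hGUC : UnionClosed G :=
    hUC.image_of_map_union _ fun S T => Finset.erase_union_distrib S T e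
  have hGdegF : ∀ x ∈ X, degOf G x ≤ a := by
    intro x hx
    obtain ⟨hxe, hxr⟩ := Finset.mem_erase.1 hx
    refine le_trans ?_ (hdeg x hxr)
    unfold degOf
    rw [hGdef, filter_image_erase hxe]
    exact Finset.card_image_le
  have hGle : G.card ≤ franklF n a :=
    card_le_franklF_of_subset_erase he hGUC hGX (hFne.image _) hGdegF
  obtain ⟨S, hS, heS, hSe⟩ :=
    exists_insert_mem_of_card_image_erase_ne (hGle.trans_lt (hopt ▸ hlt)).ne
  have hGdeg : ∀ x ∈ X, degOf G x < a := by
    intro x hx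
    obtain ⟨hxe, hxr⟩ := Finset.mem_erase.1 hx
    exact degOf_image_erase_lt hUC hxe (hdeg x hxr) (hdeg e he) heS hS hSe
  have hmissing : (X.powerset \ G).Nonempty := by
    rw [Finset.sdiff_nonempty]
    intro hsub
    obtain ⟨x, hx⟩ : X.Nonempty := Finset.card_pos.1 (by omega)
    have hGeq : G = X.powerset :=
      Finset.Subset.antisymm (fun S hS => Finset.mem_powerset.2 (hGX S hS)) hsub
    have h1 := two_pow_le_degOf_powerset hx
    rw [← hGeq, hXcard] at h1
    have h2 : a ≤ 2 ^ (n - 1) :=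
      (Nat.le_pow_clog one_lt_two a).trans (Nat.pow_le_pow_right two_pos (by omega))
    have h3 := hGdeg x hx
    omega
  obtain ⟨T, hT⟩ := Finset.exists_maximal hmissing
  obtain ⟨hTX, hTG⟩ := Finset.mem_sdiff.1 hT.prop
  have hbound : (insert T G).card ≤ franklF n a := by
    refine card_le_franklF_of_subset_erase he (hGUC.insert_of_maximal hGX hT) ?_
      (Finset.insert_nonempty _ _) fun x hx => (degOf_insert_le G T x).trans (hGdeg x hx)
    intro R hR
    rcases Finset.mem_insert.1 hR with rfl | hR
    · exact Finset.mem_powerset.1 hTX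
    · exact hGX R hR
  rw [Finset.card_insert_of_notMem hTG] at hbound
  omega
end
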